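/- Let q be a nondegenerate quadratic form on a 3-dimensional vector space over an algebraically closed field k of characteristic ≠ 2. Then the even Clifford algebra Cl₀(q) is isomorphic as a k-algebra to the algebra of 2×2 matrices over k. -/

import Mathlib

namespace CliffordAlgebra

variable {R M₁ M₂ : Type*} [CommRing R] [AddCommGroup M₁] [AddCommGroup M₂]
  [Module R M₁] [Module R M₂] {Q₁ : QuadraticForm R M₁} {Q₂ : QuadraticForm R M₂}

/-- The algebra morphism between even Clifford algebras induced by an isometry. -/
def evenMap (f : Q₁ →qᵢ Q₂) : even Q₁ →ₐ[R] even Q₂ :=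
  even.lift Q₁
    { bilin := (even.ι Q₂).bilin.compl₁₂ f.toLinearMap f.toLinearMap
      contract := fun m => ((even.ι Q₂).contract (f m)).trans (by rw [f.map_app])
      contract_mid := fun m₁ m₂ m₃ =>
        ((even.ι Q₂).contract_mid (f m₁) (f m₂) (f m₃)).trans (by rw [f.map_app]; rfl) }

@[simp]
theorem evenMap_ι (f : Q₁ →qᵢ Q₂) (x y : M₁) :
    evenMap f ((even.ι Q₁).bilin x y) = (even.ι Q₂).bilin (f x) (f y) :=
  even.lift_ι _ _ _ _

theorem evenMap_comp_evenMap_of_leftInverse (f : Q₁ →qᵢ Q₂) (g : Q₂ →qᵢ Q₁)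
    (h : Function.LeftInverse g f) : (evenMap g).comp (evenMap f) = AlgHom.id R (even Q₁) := by
  refine even.algHom_ext Q₁ (EvenHom.ext (LinearMap.ext₂ fun x y => ?_))
  simp only [EvenHom.compr₂_bilin, LinearMap.compr₂_apply, AlgHom.toLinearMap_apply,
    AlgHom.comp_apply, evenMap_ι, h x, h y, AlgHom.id_apply]

/-- Isometric quadratic forms have isomorphic even Clifford algebras. -/
def evenEquivOfIsometry (e : Q₁.IsometryEquiv Q₂) : even Q₁ ≃ₐ[R] even Q₂ :=
  AlgEquiv.ofAlgHom (evenMap e.toIsometry) (evenMap e.symm.toIsometry)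
    (evenMap_comp_evenMap_of_leftInverse _ _ e.apply_symm_apply)
    (evenMap_comp_evenMap_of_leftInverse _ _ e.symm_apply_apply)

end CliffordAlgebra

namespace QuaternionAlgebra

open scoped Quaternion

/-- The matrices `diag(1, -1)` and `antidiag(1, 1)` satisfy the relations of `ℍ[R,1,0,1]`. -/
def matrixBasis (R : Type*) [CommRing R] : Basis (Matrix (Fin 2) (Fin 2) R) (1 : R) 0 1 where
  i := !![1, 0; 0, -1]
  j := !![0, 1; 1, 0]
  k := !![0, 1; -1, 0]
  i_mul_i := by simp [Matrix.one_fin_two]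
  j_mul_j := by simp [Matrix.one_fin_two]
  i_mul_j := by simp
  j_mul_i := by simp

theorem matrixBasis_liftHom_apply {R : Type*} [CommRing R] (x : ℍ[R,1,0,1]) :
    (matrixBasis R).liftHom x =
      !![x.re + x.imI, x.imJ + x.imK; x.imJ - x.imK, x.re - x.imI] := by
  change (matrixBasis R).lift x = _
  ext i j
  fin_cases i <;> fin_cases j <;>
    simp [Basis.lift, matrixBasis, Matrix.algebraMap_matrix_apply, sub_eq_add_neg]

theorem matrixBasis_liftHom_bijective (R : Type*) [CommRing R] [Invertible (2 : R)] :
    Function.Bijective (matrixBasis R).liftHom := by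
  have half (a b : R) : ⅟2 * (a + b) + ⅟2 * (a - b) = a := by
    linear_combination a * invOf_mul_self (2 : R)
  have half' (a b : R) : ⅟2 * (a + b) - ⅟2 * (a - b) = b := by
    linear_combination b * invOf_mul_self (2 : R)
  have cancel {a b : R} (h : 2 * a = 2 * b) : a = b :=
    (isUnit_of_invertible (2 : R)).mul_left_cancel h
  refine ⟨fun x y h => ?_, fun m => ?_⟩
  · rw [matrixBasis_liftHom_apply, matrixBasis_liftHom_apply] at h
    have h00 := congrFun₂ h 0 0
    have h01 := congrFun₂ h 0 1
    have h10 := congrFun₂ h 1 0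
    have h11 := congrFun₂ h 1 1
    simp only [Matrix.of_apply, Matrix.cons_val', Matrix.cons_val_zero, Matrix.cons_val_one,
      Matrix.cons_val_fin_one] at h00 h01 h10 h11
    ext <;> apply cancel
    · linear_combination h00 + h11
    · linear_combination h00 - h11
    · linear_combination h01 + h10
    · linear_combination h01 - h10
  · refine ⟨⟨⅟2 * (m 0 0 + m 1 1), ⅟2 * (m 0 0 - m 1 1), ⅟2 * (m 0 1 + m 1 0),
      ⅟2 * (m 0 1 - m 1 0)⟩, ?_⟩
    rw [matrixBasis_liftHom_apply]
    simp only [half, half']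
    exact (Matrix.eta_fin_two m).symm

/-- The quaternion algebra `ℍ[R,1,0,1]` is split when `2` is invertible. -/
noncomputable def equivMatrix (R : Type*) [CommRing R] [Invertible (2 : R)] :
    ℍ[R,1,0,1] ≃ₐ[R] Matrix (Fin 2) (Fin 2) R :=
  AlgEquiv.ofBijective _ (matrixBasis_liftHom_bijective R)

end QuaternionAlgebra

/-- If `a ^ 2 = -1`, then `x ^ 2 + y ^ 2 - z ^ 2` is isometric to the sum of three squares. -/
def isometryEquivSumThreeSquares {R : Type*} [CommRing R] (a : R) (ha : a * a = -1) :
    (CliffordAlgebra.EquivEven.Q' (CliffordAlgebraQuaternion.Q (1 : R) 1)).IsometryEquiv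
      (QuadraticMap.weightedSumSquares R (1 : Fin 3 → R)) where
  toFun v := ![v.1.1, v.1.2, a * v.2]
  invFun w := ((w 0, w 1), -a * w 2)
  map_add' v w := by
    ext i
    fin_cases i <;> simp [mul_add]
  map_smul' c v := by
    ext i
    fin_cases i <;> simp [mul_left_comm]
  left_inv v := by
    ext <;> simp [← mul_assoc, ha]
  right_inv w := by
    ext i
    fin_cases i <;> simp [← mul_assoc, ha]
  map_app' v := by
    simp [QuadraticMap.weightedSumSquares_apply, Fin.sum_univ_three]
    linear_combination v.2 * v.2 * ha

theorem stmt_2 (k : Type*) [Field k] [IsAlgClosed k] [Invertible (2 : k)]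
    (V : Type*) [AddCommGroup V] [Module k V] [FiniteDimensional k V]
    (h3 : Module.finrank k V = 3)
    (Q : QuadraticForm k V)
    (hQ : (QuadraticMap.associated (R := k) Q).Nondegenerate) :
    Nonempty ((CliffordAlgebra.even Q) ≃ₐ[k] Matrix (Fin 2) (Fin 2) k) := by
  have equiv_sum_squares := Q.equivalent_weightedSumSquares_of_isAlgClosed hQ.1
  rw [h3] at equiv_sum_squares
  obtain ⟨e⟩ := equiv_sum_squares
  obtain ⟨a, ha⟩ := IsAlgClosed.exists_eq_mul_self (-1 : k)
  exact ⟨(CliffordAlgebra.evenEquivOfIsometry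
      (e.trans (isometryEquivSumThreeSquares a ha.symm).symm)).trans <|
    (CliffordAlgebra.equivEven _).symm.trans <|
    CliffordAlgebraQuaternion.equiv.trans <| QuaternionAlgebra.equivMatrix k⟩
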